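/- arXiv:2206.07393 — 3 statements merged into one kernel-verified Lean document; each statement's English description precedes it below -/
import Mathlib

section
/- Let σ be a finite relational vocabulary, A and B σ-structures, and k > 0. Duplicator has a winning strategy in the k-round Ehrenfeucht–Fraïssé game between A and B if and only if A and B satisfy the same first-order sentences of quantifier rank at most k. -/
namespace SP


/-- An interpretation of the relational vocabulary `(σ, ar)` on a carrier type `A`:
each relation symbol `r` of arity `ar r` is interpreted as a set of `ar r`-tuples. -/
def Interp (σ : Type) (ar : σ → ℕ) (A : Type) : Type :=
  ∀ r : σ, Set (Fin (ar r) → A)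

variable {σ : Type} {ar : σ → ℕ}

/-- `f` is a homomorphism of σ-structures. -/
def IsHom {A B : Type} (SA : Interp σ ar A) (SB : Interp σ ar B) (f : A → B) : Prop :=
  ∀ (r : σ) (t : Fin (ar r) → A), t ∈ SA r → (fun i => f (t i)) ∈ SB r

/-- Adjacency in the Gaifman graph of a σ-structure. -/
def GaifmanAdj {A : Type} (SA : Interp σ ar A) (a b : A) : Prop :=
  a ≠ b ∧ ∃ (r : σ) (t : Fin (ar r) → A), t ∈ SA r ∧ (∃ i, t i = a) ∧ (∃ j, t j = b)




/-- First-order formulas over the relational vocabulary `(σ, ar)`, with variables in `ℕ`. -/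
inductive Fml (σ : Type) (ar : σ → ℕ) : Type
  | rel (r : σ) (v : Fin (ar r) → ℕ)
  | eq (x y : ℕ)
  | not (φ : Fml σ ar)
  | and (φ ψ : Fml σ ar)
  | or (φ ψ : Fml σ ar)
  | ex (x : ℕ) (φ : Fml σ ar)
  | all (x : ℕ) (φ : Fml σ ar)

namespace Fml

variable {σ : Type} {ar : σ → ℕ}

/-- Quantifier rank. -/
def qr : Fml σ ar → ℕ
  | rel _ _ => 0
  | eq _ _ => 0
  | not φ => φ.qr
  | and φ ψ => max φ.qr ψ.qr
  | or φ ψ => max φ.qr ψ.qr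
  | ex _ φ => φ.qr + 1
  | all _ φ => φ.qr + 1

/-- Free variables. -/
def fv : Fml σ ar → Finset ℕ
  | rel _ v => Finset.univ.image v
  | eq x y => {x, y}
  | not φ => φ.fv
  | and φ ψ => φ.fv ∪ ψ.fv
  | or φ ψ => φ.fv ∪ ψ.fv
  | ex x φ => φ.fv.erase x
  | all x φ => φ.fv.erase x

/-- All variables occurring in the formula. -/
def vars : Fml σ ar → Finset ℕ
  | rel _ v => Finset.univ.image v
  | eq x y => {x, y}
  | not φ => φ.vars
  | and φ ψ => φ.vars ∪ ψ.vars
  | or φ ψ => φ.vars ∪ ψ.vars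
  | ex x φ => insert x φ.vars
  | all x φ => insert x φ.vars

/-- Existential positive formulas: built from atomic formulas using only ∧, ∨, ∃. -/
def IsEP : Fml σ ar → Prop
  | rel _ _ => True
  | eq _ _ => True
  | not _ => False
  | and φ ψ => φ.IsEP ∧ ψ.IsEP
  | or φ ψ => φ.IsEP ∧ ψ.IsEP
  | ex _ φ => φ.IsEP
  | all _ _ => False

/-- Tarskian satisfaction, relative to a variable assignment `η`. -/
def Sat {A : Type} (SA : Interp σ ar A) : (ℕ → A) → Fml σ ar → Prop
  | η, rel r v => (fun i => η (v i)) ∈ SA r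
  | η, eq x y => η x = η y
  | η, not φ => ¬ Sat SA η φ
  | η, and φ ψ => Sat SA η φ ∧ Sat SA η ψ
  | η, or φ ψ => Sat SA η φ ∨ Sat SA η ψ
  | η, ex x φ => ∃ a : A, Sat SA (Function.update η x a) φ
  | η, all x φ => ∀ a : A, Sat SA (Function.update η x a) φ

end Fml




variable {σ : Type} {ar : σ → ℕ}

/-- A relation `γ ⊆ A × B` is a partial homomorphism: a well-defined function on its
domain which preserves all relations restricted to its domain. -/
def PartialHom {A B : Type} (SA : Interp σ ar A) (SB : Interp σ ar B)
    (γ : Set (A × B)) : Prop :=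
  (∀ a b b', (a, b) ∈ γ → (a, b') ∈ γ → b = b') ∧
  ∀ (r : σ) (u : Fin (ar r) → A) (w : Fin (ar r) → B),
    (∀ i, (u i, w i) ∈ γ) → u ∈ SA r → w ∈ SB r

/-- The position reached when Spoiler has played the list `s` of elements of `A` and
Duplicator has responded according to the strategy `f` (which is given, at each round,
the list of Spoiler's moves so far). -/
def playPairs {A B : Type} (f : List A → B) (s : List A) : Set (A × B) :=
  { p | ∃ i : Fin s.length, p.1 = s.get i ∧ p.2 = f (s.take ((i : ℕ) + 1)) }

/-- Duplicator has a winning strategy in the `k`-round existential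
Ehrenfeucht–Fraïssé game from `A` to `B`. -/
def ExEFWin {A B : Type} (SA : Interp σ ar A) (SB : Interp σ ar B) (k : ℕ) : Prop :=
  ∃ f : List A → B, ∀ s : List A, s.length = k → PartialHom SA SB (playPairs f s)

/-- A relation `γ ⊆ A × B` is a partial isomorphism: a well-defined injective function
on its domain which preserves and reflects all relations restricted to its domain. -/
def PartialIso {A B : Type} (SA : Interp σ ar A) (SB : Interp σ ar B)
    (γ : Set (A × B)) : Prop :=
  (∀ a b b', (a, b) ∈ γ → (a, b') ∈ γ → b = b') ∧
  (∀ a a' b, (a, b) ∈ γ → (a', b) ∈ γ → a = a') ∧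
  ∀ (r : σ) (u : Fin (ar r) → A) (w : Fin (ar r) → B),
    (∀ i, (u i, w i) ∈ γ) → (u ∈ SA r ↔ w ∈ SB r)

/-- A Duplicator strategy in the (back-and-forth) Ehrenfeucht–Fraïssé game: given the
history of the play so far, it answers a Spoiler move in `A` by an element of `B`,
and a Spoiler move in `B` by an element of `A`. -/
structure EFStrategy (A B : Type) where
  fA : List (A × B) → A → B
  fB : List (A × B) → B → A

/-- The plays (histories) that can be reached when Duplicator follows the strategy `st`. -/
inductive Reach {A B : Type} (st : EFStrategy A B) : List (A × B) → Prop
  | nil : Reach st []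
  | moveA (h : List (A × B)) (a : A) : Reach st h → Reach st (h ++ [(a, st.fA h a)])
  | moveB (h : List (A × B)) (b : B) : Reach st h → Reach st (h ++ [(st.fB h b, b)])

/-- Duplicator has a winning strategy in the `k`-round Ehrenfeucht–Fraïssé game
between `A` and `B`. -/
def EFWin {A B : Type} (SA : Interp σ ar A) (SB : Interp σ ar B) (k : ℕ) : Prop :=
  ∃ st : EFStrategy A B, ∀ h : List (A × B), Reach st h → h.length = k →
    PartialIso SA SB { p | p ∈ h }



/-- Duplicator wins `n` more rounds from position `h`. -/
def WinFrom {A B : Type} (SA : Interp σ ar A) (SB : Interp σ ar B) : ℕ → List (A × B) → Prop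
  | 0, h => PartialIso SA SB { p | p ∈ h }
  | n + 1, h => (∀ a, ∃ b, WinFrom SA SB n (h ++ [(a, b)])) ∧
      (∀ b, ∃ a, WinFrom SA SB n (h ++ [(a, b)]))

theorem PartialIso.mono {A B : Type} {SA : Interp σ ar A} {SB : Interp σ ar B}
    {s t : Set (A × B)} (hst : s ⊆ t) (h : PartialIso SA SB t) : PartialIso SA SB s :=
  ⟨fun a b b' h1 h2 => h.1 a b b' (hst h1) (hst h2),
   fun a b b' h1 h2 => h.2.1 a b b' (hst h1) (hst h2),
   fun r u w hu => h.2.2 r u w (fun i => hst (hu i))⟩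

theorem WinFrom.iso {A B : Type} {SA : Interp σ ar A} {SB : Interp σ ar B} [Nonempty A]
    (n : ℕ) : ∀ h : List (A × B), WinFrom SA SB n h → PartialIso SA SB { p | p ∈ h } := by
  induction n with
  | zero => intro h hw; exact hw
  | succ n ih =>
    intro h hw
    obtain ⟨b, hb⟩ := hw.1 (Classical.arbitrary A)
    refine PartialIso.mono ?_ (ih _ hb)
    intro p hp
    exact List.mem_append_left _ hp

theorem WinFrom.of_strategy {A B : Type} {SA : Interp σ ar A} {SB : Interp σ ar B} {k : ℕ}
    (st : EFStrategy A B)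
    (hst : ∀ h : List (A × B), Reach st h → h.length = k → PartialIso SA SB { p | p ∈ h })
    (n : ℕ) : ∀ h, Reach st h → h.length + n = k → WinFrom SA SB n h := by
  induction n with
  | zero => intro h hr hl; exact hst h hr (by omega)
  | succ n ih =>
    intro h hr hl
    refine ⟨fun a => ⟨st.fA h a, ih _ (Reach.moveA h a hr) ?_⟩,
      fun b => ⟨st.fB h b, ih _ (Reach.moveB h b hr) ?_⟩⟩ <;>
    · simp; omega

theorem WinFrom.to_strategy {A B : Type} {SA : Interp σ ar A} {SB : Interp σ ar B}
    [Nonempty A] [Nonempty B] {k : ℕ} (hw : WinFrom SA SB k []) : EFWin SA SB k := by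
  classical
  let st : EFStrategy A B :=
    { fA := fun h a => Classical.epsilon fun b => WinFrom SA SB (k - (h.length + 1)) (h ++ [(a, b)])
      fB := fun h b => Classical.epsilon fun a => WinFrom SA SB (k - (h.length + 1)) (h ++ [(a, b)]) }
  have key : ∀ h, Reach st h → h.length ≤ k → WinFrom SA SB (k - h.length) h := by
    intro h hr
    induction hr with
    | nil => intro _; exact hw
    | moveA h a hr ih =>
      intro hl
      simp only [List.length_append, List.length_cons, List.length_nil, zero_add] at hl ⊢
      have h1 := ih (by omega)
      rw [show k - h.length = (k - (h.length + 1)) + 1 by omega] at h1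
      exact Classical.epsilon_spec (h1.1 a)
    | moveB h b hr ih =>
      intro hl
      simp only [List.length_append, List.length_cons, List.length_nil, zero_add] at hl ⊢
      have h1 := ih (by omega)
      rw [show k - h.length = (k - (h.length + 1)) + 1 by omega] at h1
      exact Classical.epsilon_spec (h1.2 b)
  refine ⟨st, fun h hr hl => ?_⟩
  have := key h hr hl.le
  rw [hl, Nat.sub_self] at this
  exact this

theorem sat_congr {A : Type} (SA : Interp σ ar A) (φ : Fml σ ar) :
    ∀ η θ : ℕ → A, (∀ x ∈ φ.fv, η x = θ x) → (Fml.Sat SA η φ ↔ Fml.Sat SA θ φ) := by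
  induction φ with
  | rel r v =>
    intro η θ h
    have : (fun i => η (v i)) = (fun i => θ (v i)) := by
      funext i; exact h _ (by simp [Fml.fv])
    simp only [Fml.Sat, this]
  | eq x y =>
    intro η θ h
    simp only [Fml.Sat, h x (by simp [Fml.fv]), h y (by simp [Fml.fv])]
  | not φ ih => intro η θ h; simp only [Fml.Sat]; rw [ih η θ h]
  | and φ ψ ih1 ih2 =>
    intro η θ h; simp only [Fml.Sat]
    rw [ih1 η θ (fun x hx => h x (by simp [Fml.fv, hx])),
      ih2 η θ (fun x hx => h x (by simp [Fml.fv, hx]))]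
  | or φ ψ ih1 ih2 =>
    intro η θ h; simp only [Fml.Sat]
    rw [ih1 η θ (fun x hx => h x (by simp [Fml.fv, hx])),
      ih2 η θ (fun x hx => h x (by simp [Fml.fv, hx]))]
  | ex x φ ih =>
    intro η θ h; simp only [Fml.Sat]
    refine exists_congr fun a => ih _ _ fun y hy => ?_
    by_cases hyx : y = x
    · subst hyx; simp
    · simp [hyx, h y (by simp [Fml.fv, hy, hyx])]
  | all x φ ih =>
    intro η θ h; simp only [Fml.Sat]
    refine forall_congr' fun a => ih _ _ fun y hy => ?_
    by_cases hyx : y = x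
    · subst hyx; simp
    · simp [hyx, h y (by simp [Fml.fv, hy, hyx])]

theorem update_mem {A B : Type} {h : List (A × B)} {η : ℕ → A} {θ : ℕ → B} {x : ℕ}
    {s : Finset ℕ} (hh : ∀ y ∈ s.erase x, (η y, θ y) ∈ h) (a : A) (b : B) :
    ∀ y ∈ s, (Function.update η x a y, Function.update θ x b y) ∈ h ++ [(a, b)] := by
  intro y hy
  by_cases hyx : y = x
  · subst hyx; simp
  · have := hh y (by simp [hy, hyx])
    simp [hyx, this]

theorem WinFrom.sat {A B : Type} {SA : Interp σ ar A} {SB : Interp σ ar B} [Nonempty A]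
    (φ : Fml σ ar) : ∀ (n : ℕ) (h : List (A × B)) (η : ℕ → A) (θ : ℕ → B),
      WinFrom SA SB n h → φ.qr ≤ n → (∀ x ∈ φ.fv, (η x, θ x) ∈ h) →
      (Fml.Sat SA η φ ↔ Fml.Sat SB θ φ) := by
  induction φ with
  | rel r v =>
    intro n h η θ hw hq hh
    exact (WinFrom.iso n h hw).2.2 r _ _ (fun i => hh (v i) (by simp [Fml.fv]))
  | eq x y =>
    intro n h η θ hw hq hh
    have hi := WinFrom.iso n h hw
    have hx := hh x (by simp [Fml.fv])
    have hy := hh y (by simp [Fml.fv])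
    simp only [Fml.Sat]
    constructor
    · intro e; rw [← e] at hy; exact hi.1 _ _ _ hx hy
    · intro e; rw [← e] at hy; exact hi.2.1 _ _ _ hx hy
  | not φ ih => intro n h η θ hw hq hh; simp only [Fml.Sat]; rw [ih n h η θ hw hq hh]
  | and φ ψ ih1 ih2 =>
    intro n h η θ hw hq hh
    simp only [Fml.qr, max_le_iff] at hq
    simp only [Fml.Sat]
    rw [ih1 n h η θ hw hq.1 (fun x hx => hh x (by simp [Fml.fv, hx])),
      ih2 n h η θ hw hq.2 (fun x hx => hh x (by simp [Fml.fv, hx]))]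
  | or φ ψ ih1 ih2 =>
    intro n h η θ hw hq hh
    simp only [Fml.qr, max_le_iff] at hq
    simp only [Fml.Sat]
    rw [ih1 n h η θ hw hq.1 (fun x hx => hh x (by simp [Fml.fv, hx])),
      ih2 n h η θ hw hq.2 (fun x hx => hh x (by simp [Fml.fv, hx]))]
  | ex x φ ih =>
    intro n h η θ hw hq hh
    simp only [Fml.qr] at hq
    obtain ⟨m, rfl⟩ : ∃ m, n = m + 1 := ⟨n - 1, by omega⟩
    simp only [Fml.Sat]
    constructor
    · rintro ⟨a, ha⟩
      obtain ⟨b, hb⟩ := hw.1 a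
      exact ⟨b, (ih m _ _ _ hb (by omega) (update_mem hh a b)).1 ha⟩
    · rintro ⟨b, hb'⟩
      obtain ⟨a, ha⟩ := hw.2 b
      exact ⟨a, (ih m _ _ _ ha (by omega) (update_mem hh a b)).2 hb'⟩
  | all x φ ih =>
    intro n h η θ hw hq hh
    simp only [Fml.qr] at hq
    obtain ⟨m, rfl⟩ : ∃ m, n = m + 1 := ⟨n - 1, by omega⟩
    simp only [Fml.Sat]
    constructor
    · intro H b
      obtain ⟨a, ha⟩ := hw.2 b
      exact (ih m _ _ _ ha (by omega) (update_mem hh a b)).1 (H a)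
    · intro H a
      obtain ⟨b, hb⟩ := hw.1 a
      exact (ih m _ _ _ hb (by omega) (update_mem hh a b)).2 (H b)

/-- Finitely many complete types over a finite list of formulas. -/
theorem exists_types (n m : ℕ) (L : List (Fml σ ar))
    (hL : ∀ φ ∈ L, φ.qr ≤ n ∧ φ.fv ⊆ Finset.range (m + 1)) :
    ∃ T : List (Fml σ ar), (∀ φ ∈ T, φ.qr ≤ n ∧ φ.fv ⊆ Finset.range (m + 1)) ∧
      ∀ (C : Type) (SC : Interp σ ar C) (η : ℕ → C), ∃ τ ∈ T, Fml.Sat SC η τ ∧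
        ∀ (D : Type) (SD : Interp σ ar D) (θ : ℕ → D), Fml.Sat SD θ τ →
          ∀ φ ∈ L, (Fml.Sat SC η φ ↔ Fml.Sat SD θ φ) := by
  induction L with
  | nil =>
    refine ⟨[Fml.eq m m], ?_, ?_⟩
    · intro φ hφ
      simp only [List.mem_singleton] at hφ
      subst hφ
      simp [Fml.qr, Fml.fv]
    · intro C SC η
      exact ⟨Fml.eq m m, by simp, by simp [Fml.Sat], by simp⟩
  | cons φ L ih =>
    obtain ⟨T, hT, hT2⟩ := ih (fun ψ hψ => hL ψ (by simp [hψ]))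
    have hφ := hL φ (by simp)
    refine ⟨T.map (Fml.and φ) ++ T.map (Fml.and (Fml.not φ)), ?_, ?_⟩
    · intro ψ hψ
      simp only [List.mem_append, List.mem_map] at hψ
      rcases hψ with ⟨τ, hτ, rfl⟩ | ⟨τ, hτ, rfl⟩ <;>
      exact ⟨max_le hφ.1 (hT τ hτ).1, Finset.union_subset hφ.2 (hT τ hτ).2⟩
    · intro C SC η
      obtain ⟨τ, hτ, hs, hd⟩ := hT2 C SC η
      by_cases hc : Fml.Sat SC η φ
      · refine ⟨Fml.and φ τ, by simp [hτ], ⟨hc, hs⟩, ?_⟩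
        rintro D SD θ ⟨h1, h2⟩ ψ hψ
        rcases List.mem_cons.1 hψ with rfl | hψ
        · exact iff_of_true hc h1
        · exact hd D SD θ h2 ψ hψ
      · refine ⟨Fml.and (Fml.not φ) τ, by simp [hτ], ⟨hc, hs⟩, ?_⟩
        rintro D SD θ ⟨h1, h2⟩ ψ hψ
        rcases List.mem_cons.1 hψ with rfl | hψ
        · exact iff_of_false hc h1
        · exact hd D SD θ h2 ψ hψ

theorem map_update {A B : Type} (η : ℕ → A) (θ : ℕ → B) (m : ℕ) (a : A) (b : B) :
    (List.range (m + 1)).map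
      (fun i => (Function.update η m a i, Function.update θ m b i)) =
    (List.range m).map (fun i => (η i, θ i)) ++ [(a, b)] := by
  rw [List.range_succ, List.map_append]
  congr 1
  · apply List.map_congr_left
    intro i hi
    have : i ≠ m := (List.mem_range.1 hi).ne
    simp [this]
  · simp

theorem exists_list [Fintype σ] {A B : Type} (SA : Interp σ ar A) (SB : Interp σ ar B) (n : ℕ) :
    ∀ m : ℕ, ∃ L : List (Fml σ ar), (∀ φ ∈ L, φ.qr ≤ n ∧ φ.fv ⊆ Finset.range m) ∧
      ∀ (η : ℕ → A) (θ : ℕ → B), (∀ φ ∈ L, (Fml.Sat SA η φ ↔ Fml.Sat SB θ φ)) →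
        WinFrom SA SB n ((List.range m).map (fun i => (η i, θ i))) := by
  induction n with
  | zero =>
    intro m
    refine ⟨(Finset.univ : Finset (Σ r : σ, (Fin (ar r) → Fin m))).toList.map
        (fun p => Fml.rel p.1 (fun i => (p.2 i : ℕ))) ++
      (Finset.univ : Finset (Fin m × Fin m)).toList.map
        (fun p => Fml.eq (p.1 : ℕ) (p.2 : ℕ)), ?_, ?_⟩
    · intro φ hφ
      simp only [List.mem_append, List.mem_map] at hφ
      rcases hφ with ⟨p, -, rfl⟩ | ⟨p, -, rfl⟩
      · refine ⟨le_rfl, ?_⟩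
        intro x hx
        simp only [Fml.fv, Finset.mem_image] at hx
        obtain ⟨i, -, rfl⟩ := hx
        simp
      · refine ⟨le_rfl, ?_⟩
        intro x hx
        simp only [Fml.fv, Finset.mem_insert, Finset.mem_singleton] at hx
        rcases hx with rfl | rfl <;> simp
    · intro η θ H
      have heq : ∀ i j, i < m → j < m → (η i = η j ↔ θ i = θ j) := by
        intro i j hi hj
        refine H (Fml.eq i j) (List.mem_append_right _ (List.mem_map.2 ⟨(⟨i, hi⟩, ⟨j, hj⟩), ?_, rfl⟩))
        simp
      have hmem : ∀ a b, (a, b) ∈ (List.range m).map (fun i => (η i, θ i)) →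
          ∃ i, i < m ∧ η i = a ∧ θ i = b := by
        intro a b h
        simpa using h
      refine ⟨?_, ?_, ?_⟩
      · intro a b b' h1 h2
        obtain ⟨i, hi, rfl, rfl⟩ := hmem _ _ h1
        obtain ⟨j, hj, e, rfl⟩ := hmem _ _ h2
        exact (heq i j hi hj).1 e.symm
      · intro a b b' h1 h2
        obtain ⟨i, hi, rfl, rfl⟩ := hmem _ _ h1
        obtain ⟨j, hj, rfl, e⟩ := hmem _ _ h2
        exact (heq i j hi hj).2 e.symm
      · intro r u w h
        choose v hv hu hw using fun i => hmem _ _ (h i)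
        have := H (Fml.rel r v) (List.mem_append_left _
          (List.mem_map.2 ⟨⟨r, fun i => ⟨v i, hv i⟩⟩, by simp, rfl⟩))
        simp only [Fml.Sat, hu, hw] at this
        exact this
  | succ n ih =>
    intro m
    obtain ⟨L, hL, hW⟩ := ih (m + 1)
    obtain ⟨T, hT, hT2⟩ := exists_types n m L hL
    refine ⟨T.map (Fml.ex m), ?_, ?_⟩
    · intro φ hφ
      obtain ⟨τ, hτ, rfl⟩ := List.mem_map.1 hφ
      refine ⟨Nat.succ_le_succ (hT τ hτ).1, ?_⟩
      intro x hx
      simp only [Fml.fv, Finset.mem_erase] at hx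
      have := (hT τ hτ).2 hx.2
      simp only [Finset.mem_range] at this ⊢
      omega
    · intro η θ H
      constructor
      · intro a
        obtain ⟨τ, hτ, hs, hd⟩ := hT2 A SA (Function.update η m a)
        obtain ⟨b, hb⟩ := (H _ (List.mem_map_of_mem hτ)).1 ⟨a, hs⟩
        refine ⟨b, ?_⟩
        rw [← map_update]
        exact hW _ _ (hd B SB _ hb)
      · intro b
        obtain ⟨τ, hτ, hs, hd⟩ := hT2 B SB (Function.update θ m b)
        obtain ⟨a, ha⟩ := (H _ (List.mem_map_of_mem hτ)).2 ⟨b, hs⟩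
        refine ⟨a, ?_⟩
        rw [← map_update]
        exact hW _ _ (fun φ hφ => (hd A SA _ ha φ hφ).symm)

theorem sat_all_iff {A : Type} (SA : Interp σ ar A) (φ : Fml σ ar) (hφ : φ.fv = ∅) (η : ℕ → A) :
    (∀ η : ℕ → A, Fml.Sat SA η φ) ↔ Fml.Sat SA η φ :=
  ⟨fun h => h η, fun h θ => (sat_congr SA φ η θ (by simp [hφ])).1 h⟩

/-- For a finite relational vocabulary σ, σ-structures A, B and
`k > 0`: Duplicator has a winning strategy in the `k`-round Ehrenfeucht–Fraïssé game
between A and B iff A and B satisfy the same first-order sentences of quantifier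
rank at most `k`. -/
theorem stmt1 {σ : Type} [Fintype σ] {ar : σ → ℕ} (har : ∀ r, 0 < ar r)
    {A B : Type} (SA : Interp σ ar A) (SB : Interp σ ar B) (k : ℕ) (hk : 0 < k) :
    EFWin SA SB k ↔
      ∀ φ : Fml σ ar, φ.qr ≤ k → φ.fv = ∅ →
        ((∀ η : ℕ → A, Fml.Sat SA η φ) ↔ (∀ η : ℕ → B, Fml.Sat SB η φ)) := by
  rcases isEmpty_or_nonempty A with hA | hA <;> rcases isEmpty_or_nonempty B with hB | hB
  · constructor
    · intro _ φ _ _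
      exact ⟨fun _ η => isEmptyElim (η 0), fun _ η => isEmptyElim (η 0)⟩
    · intro _
      refine ⟨⟨fun _ a => isEmptyElim a, fun _ b => isEmptyElim b⟩, fun h _ _ => ?_⟩
      exact ⟨fun a => isEmptyElim a, fun a => isEmptyElim a,
        fun r u => isEmptyElim (u ⟨0, har r⟩)⟩
  · constructor
    · rintro ⟨st, -⟩
      exact isEmptyElim (st.fB [] (Classical.arbitrary B))
    · intro H
      have h1 := (H (Fml.all 0 (Fml.not (Fml.eq 0 0))) (by simp [Fml.qr]; omega)
        (by simp [Fml.fv])).1 (fun η => isEmptyElim (η 0))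
      exact absurd rfl (h1 (fun _ => Classical.arbitrary B) (Classical.arbitrary B))
  · constructor
    · rintro ⟨st, -⟩
      exact isEmptyElim (st.fA [] (Classical.arbitrary A))
    · intro H
      have h1 := (H (Fml.all 0 (Fml.not (Fml.eq 0 0))) (by simp [Fml.qr]; omega)
        (by simp [Fml.fv])).2 (fun η => isEmptyElim (η 0))
      exact absurd rfl (h1 (fun _ => Classical.arbitrary A) (Classical.arbitrary A))
  · let η : ℕ → A := fun _ => Classical.arbitrary A
    let θ : ℕ → B := fun _ => Classical.arbitrary B
    constructor
    · rintro ⟨st, hst⟩ φ hq hf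
      rw [sat_all_iff SA φ hf η, sat_all_iff SB φ hf θ]
      exact WinFrom.sat φ k [] η θ (WinFrom.of_strategy st hst k [] Reach.nil (by simp)) hq
        (by simp [hf])
    · intro H
      obtain ⟨L, hL, hW⟩ := exists_list SA SB k 0
      apply WinFrom.to_strategy
      refine hW η θ (fun φ hφ => ?_)
      have hf : φ.fv = ∅ := Finset.subset_empty.1 (by simpa using (hL φ hφ).2)
      rw [← sat_all_iff SA φ hf η, ← sat_all_iff SB φ hf θ]
      exact H φ (hL φ hφ).1 hf


end SP
end

section
/- Let σ be a relational vocabulary, A a σ-structure, and k > 0. For every forest-ordered σ-structure T of height at most k and every σ-homomorphism f from the underlying σ-structure of T to A, there is a unique morphism f̂ : T → G_k A of forest-ordered σ-structures such that ε_A ∘ f̂ = f, where ε_A : G_k A → A sends a sequence to its last element. (Thus the forgetful functor U_k : RT_k(σ) → the category of σ-structures has right adjoint G_k, with counit ε.) -/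
namespace SP


variable {σ : Type} {ar : σ → ℕ}

/-- An order-enriched σ-structure: a σ-structure together with a binary relation `le`
on its universe.  (Forest-ordered σ-structures are those satisfying `IsRT`.) -/
structure OStruct (σ : Type) (ar : σ → ℕ) where
  carrier : Type
  interp : Interp σ ar carrier
  le : carrier → carrier → Prop

namespace OStruct

variable {σ : Type} {ar : σ → ℕ} (X : OStruct σ ar)

/-- The strict order associated to `le`. -/
def slt (x y : X.carrier) : Prop := X.le x y ∧ x ≠ y

/-- `le` is a forest order: a partial order in which the set of strict predecessors of
every element is a finite chain. -/
def IsForestOrder : Prop :=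
  (∀ x, X.le x x) ∧ (∀ x y, X.le x y → X.le y x → x = y) ∧
  (∀ x y z, X.le x y → X.le y z → X.le x z) ∧
  (∀ x, { y | X.slt y x }.Finite) ∧ (∀ x, IsChain X.le { y | X.slt y x })

/-- Condition (E): elements adjacent in the Gaifman graph are comparable. -/
def CondE : Prop := ∀ a b, GaifmanAdj X.interp a b → X.le a b ∨ X.le b a

/-- The forest order has height at most `k`: every chain has cardinality at most `k`. -/
def HeightLE (k : ℕ) : Prop :=
  ∀ s : Finset X.carrier, IsChain X.le (↑s : Set X.carrier) → s.card ≤ k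

/-- `X` is an object of `RT_k(σ)`: a forest-ordered σ-structure (condition (E))
of height at most `k`. -/
def IsRT (k : ℕ) : Prop := X.IsForestOrder ∧ X.CondE ∧ X.HeightLE k

/-- A root: a minimal element of the order. -/
def IsRoot (x : X.carrier) : Prop := ∀ y, X.le y x → y = x

/-- The covering relation of the order. -/
def Covers (x y : X.carrier) : Prop :=
  X.slt x y ∧ ∀ z, X.le x z → X.le z y → z = x ∨ z = y

/-- A path: an object of `RT_k(σ)` whose order is a finite chain. -/
def IsPath (k : ℕ) : Prop :=
  X.IsRT k ∧ Finite X.carrier ∧ ∀ x y : X.carrier, X.le x y ∨ X.le y x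

end OStruct

variable {σ : Type} {ar : σ → ℕ}

/-- Morphisms of forest-ordered σ-structures: σ-homomorphisms preserving roots and
the covering relation. -/
def IsFMor (X Y : OStruct σ ar) (f : X.carrier → Y.carrier) : Prop :=
  IsHom X.interp Y.interp f ∧
  (∀ x, X.IsRoot x → Y.IsRoot (f x)) ∧
  (∀ x y, X.Covers x y → Y.Covers (f x) (f y))

/-- An embedding of σ-structures: an injective homomorphism reflecting all relations.
(Here only the injectivity/reflection part; being a homomorphism is required separately.) -/
def IsStrEmb (X Y : OStruct σ ar) (f : X.carrier → Y.carrier) : Prop :=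
  Function.Injective f ∧
  ∀ (r : σ) (t : Fin (ar r) → X.carrier),
    (fun i => f (t i)) ∈ Y.interp r → t ∈ X.interp r

/-- A path embedding into `X`: a morphism from a path which is an embedding of
σ-structures. -/
def IsPathEmb (k : ℕ) (P X : OStruct σ ar) (m : P.carrier → X.carrier) : Prop :=
  P.IsPath k ∧ IsFMor P X m ∧ IsStrEmb P X m

/-- A pathwise embedding: composition with any path embedding is a path embedding. -/
def IsPathwiseEmb (k : ℕ) (X Y : OStruct σ ar) (f : X.carrier → Y.carrier) : Prop :=
  ∀ (P : OStruct σ ar) (m : P.carrier → X.carrier),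
    IsPathEmb k P X m → IsPathEmb k P Y (fun p => f (m p))

/-- Open maps: the path-lifting property.  Every commutative square whose vertical
sides are path embeddings and whose top side is a morphism of paths has a diagonal
filler. -/
def IsOpen (k : ℕ) (X Y : OStruct σ ar) (f : X.carrier → Y.carrier) : Prop :=
  ∀ (P Q : OStruct σ ar) (mP : P.carrier → X.carrier) (mQ : Q.carrier → Y.carrier)
    (i : P.carrier → Q.carrier),
    IsPathEmb k P X mP → IsPathEmb k Q Y mQ → IsFMor P Q i →
    (∀ p, f (mP p) = mQ (i p)) →
    ∃ j : Q.carrier → X.carrier,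
      IsFMor Q X j ∧ (∀ p, j (i p) = mP p) ∧ (∀ q, f (j q) = mQ q)

/-- Bisimilarity in `RT_k(σ)`: a span of open pathwise embeddings. -/
def Bisimilar (k : ℕ) (X Y : OStruct σ ar) : Prop :=
  ∃ (R : OStruct σ ar) (f : R.carrier → X.carrier) (g : R.carrier → Y.carrier),
    R.IsRT k ∧
    IsFMor R X f ∧ IsPathwiseEmb k R X f ∧ IsOpen k R X f ∧
    IsFMor R Y g ∧ IsPathwiseEmb k R Y g ∧ IsOpen k R Y g




variable {σ : Type} {ar : σ → ℕ}

/-- The universe of `E_k A`: nonempty sequences of elements of `A` of length at most `k`. -/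
def EkCarrier (k : ℕ) (A : Type) : Type :=
  { s : List A // s ≠ [] ∧ s.length ≤ k }

/-- The counit `ε_A : E_k A → A`, sending a sequence to its last element. -/
def εE {k : ℕ} {A : Type} (s : EkCarrier k A) : A := s.1.getLast s.2.1

/-- The interpretation of the relation symbols on `E_k A`: tuples of pairwise
prefix-comparable sequences whose last elements are related in `A`. -/
def EkInterp (k : ℕ) {A : Type} (SA : Interp σ ar A) : Interp σ ar (EkCarrier k A) :=
  fun r =>
    { t | (∀ i j, (t i).1 <+: (t j).1 ∨ (t j).1 <+: (t i).1) ∧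
          (fun i => εE (t i)) ∈ SA r }

/-- `G_k A`: the cofree forest-ordered σ-structure on `A`, with the prefix order. -/
def GkO (k : ℕ) {A : Type} (SA : Interp σ ar A) : OStruct σ ar :=
  ⟨EkCarrier k A, EkInterp k SA, fun s t => s.1 <+: t.1⟩



section helpers

theorem gk_root {σ : Type} {ar : σ → ℕ} {k : ℕ} {A : Type} (SA : Interp σ ar A)
    (hk : 0 < k) (s : EkCarrier k A) (h : (GkO k SA).IsRoot s) : s.1 = [εE s] := by
  obtain ⟨l, hl, hlen⟩ := s
  cases l with
  | nil => exact absurd rfl hl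
  | cons a l =>
    have := h ⟨[a], by simp, hk⟩ (by exact ⟨l, rfl⟩)
    have h2 : [a] = a :: l := congrArg Subtype.val this
    simp only [List.cons.injEq, true_and] at h2
    subst h2
    rfl

theorem gk_root' {σ : Type} {ar : σ → ℕ} {k : ℕ} {A : Type} (SA : Interp σ ar A)
    (s : EkCarrier k A) (a : A) (h : s.1 = [a]) : (GkO k SA).IsRoot s := by
  intro t ht
  have ht : t.1 <+: s.1 := ht
  apply Subtype.ext
  apply ht.eq_of_length_le
  rw [h]
  exact List.length_pos_iff.2 t.2.1

theorem gk_cov {σ : Type} {ar : σ → ℕ} {k : ℕ} {A : Type} (SA : Interp σ ar A)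
    (s t : EkCarrier k A) (h : (GkO k SA).Covers s t) : t.1 = s.1 ++ [εE t] := by
  obtain ⟨⟨h1, h2⟩, h3⟩ := h
  have h1 : s.1 <+: t.1 := h1
  obtain ⟨u, hu⟩ := h1
  cases u with
  | nil =>
    exact absurd (Subtype.ext (by simpa using hu)) h2
  | cons a v =>
    have hl : t.1.length ≤ k := t.2.2
    rw [← hu] at hl
    have hlen : (s.1 ++ [a]).length ≤ k := by
      simp at hl ⊢; omega
    rcases h3 ⟨s.1 ++ [a], by simp, hlen⟩ (by exact ⟨[a], rfl⟩)
      (by exact ⟨v, by simpa using hu⟩) with h | h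
    · have := congrArg (fun z : EkCarrier k A => z.1.length) h
      simp at this
    · subst h
      simp [εE]

theorem gk_cov' {σ : Type} {ar : σ → ℕ} {k : ℕ} {A : Type} (SA : Interp σ ar A)
    (s t : EkCarrier k A) (a : A) (h : t.1 = s.1 ++ [a]) : (GkO k SA).Covers s t := by
  refine ⟨⟨⟨[a], h.symm⟩, ?_⟩, ?_⟩
  · rintro rfl
    have := congrArg List.length h
    simp at this
  · intro z hz1 hz2
    have hz1 : s.1 <+: z.1 := hz1
    have hz2 : z.1 <+: t.1 := hz2
    have l1 := hz1.length_le
    have l2 := hz2.length_le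
    have l3 : t.1.length = s.1.length + 1 := by rw [h]; simp
    by_cases hc : z.1.length = s.1.length
    · left; exact Subtype.ext (hz1.eq_of_length hc.symm).symm
    · right; exact Subtype.ext (hz2.eq_of_length (by omega))

variable {σ : Type} {ar : σ → ℕ} {T : OStruct σ ar}

theorem exists_cov (h : T.IsForestOrder) (x y : T.carrier) (hxy : T.slt x y) :
    ∃ p, T.Covers p y ∧ T.le x p := by
  obtain ⟨hr, ha, ht, hfin, hch⟩ := h
  letI : PartialOrder T.carrier :=
    { le := T.le, le_refl := hr, le_trans := ht, le_antisymm := ha }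
  obtain ⟨p, hp1, hp2⟩ := (hfin y).exists_le_maximal (a := x) hxy
  refine ⟨p, ⟨hp2.1, ?_⟩, hp1⟩
  intro z hz1 hz2
  by_cases hzy : z = y
  · exact Or.inr hzy
  · left
    exact ha _ _ (hp2.2 (show T.slt z y from ⟨hz2, hzy⟩) hz1) hz1

theorem cov_unique (h : T.IsForestOrder) (p q y : T.carrier)
    (hp : T.Covers p y) (hq : T.Covers q y) : p = q := by
  obtain ⟨hr, ha, ht, hfin, hch⟩ := h
  by_contra hne
  rcases hch y hp.1 hq.1 hne with h | h
  · rcases hp.2 q h hq.1.1 with e | e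
    · exact hne e.symm
    · exact hq.1.2 e
  · rcases hq.2 p h hp.1.1 with e | e
    · exact hne e
    · exact hp.1.2 e

theorem f_wf (h : T.IsForestOrder) : WellFounded T.slt := by
  obtain ⟨hr, ha, ht, hfin, hch⟩ := h
  apply Subrelation.wf (r := InvImage (· < ·) (fun x => {y | T.slt y x}.ncard)) _
    (InvImage.wf _ Nat.lt_wfRel.wf)
  intro x y hxy
  apply Set.ncard_lt_ncard _ (hfin y)
  refine ⟨?_, ?_⟩
  · intro z hz
    refine ⟨ht _ _ _ hz.1 hxy.1, ?_⟩
    rintro rfl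
    exact hz.2 (ha _ _ hz.1 hxy.1)
  · intro hh
    exact (hh hxy).2 rfl

theorem root_or_cov (h : T.IsForestOrder) (y : T.carrier) :
    T.IsRoot y ∨ ∃ p, T.Covers p y := by
  by_cases hy : T.IsRoot y
  · exact Or.inl hy
  · right
    simp only [OStruct.IsRoot, not_forall] at hy
    obtain ⟨x, hx, hne⟩ := hy
    obtain ⟨p, hp, _⟩ := exists_cov h x y ⟨hx, hne⟩
    exact ⟨p, hp⟩

/-- Paths of predecessors. -/
inductive PathTo (T : OStruct σ ar) : T.carrier → List T.carrier → Prop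
  | root (x) : T.IsRoot x → PathTo T x [x]
  | step (p y l) : T.Covers p y → PathTo T p l → PathTo T y (l ++ [y])

theorem path_exists (h : T.IsForestOrder) (y : T.carrier) : ∃ l, PathTo T y l := by
  induction y using (f_wf h).induction with
  | _ y ih =>
    rcases root_or_cov h y with hy | ⟨p, hp⟩
    · exact ⟨_, .root _ hy⟩
    · obtain ⟨l, hl⟩ := ih p hp.1
      exact ⟨_, .step _ _ _ hp hl⟩

theorem path_unique (h : T.IsForestOrder) (y : T.carrier) (l m : List T.carrier)
    (hl : PathTo T y l) (hm : PathTo T y m) : l = m := by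
  induction hl generalizing m with
  | root x hx =>
    cases hm with
    | root => rfl
    | step p _ l hp _ => exact absurd (hx _ hp.1.1) hp.1.2
  | step p y l hp hl ih =>
    cases hm with
    | root _ hx => exact absurd (hx _ hp.1.1) hp.1.2
    | step q _ m hq hm =>
      obtain rfl := cov_unique h p q y hp hq
      rw [ih m hm]

theorem path_props (h : T.IsForestOrder) (y : T.carrier) (l : List T.carrier)
    (hl : PathTo T y l) : l.Nodup ∧ ∀ z ∈ l, T.le z y := by
  obtain ⟨hr, ha, ht, hfin, hch⟩ := h
  induction hl with
  | root x hx => simp [hr]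
  | step p y l hp hl ih =>
    constructor
    · rw [List.nodup_append]
      refine ⟨ih.1, by simp, ?_⟩
      intro a hal b hb hab
      simp only [List.mem_singleton] at hb
      subst hb
      subst hab
      exact hp.1.2 (ha _ _ hp.1.1 (ih.2 _ hal))
    · intro z hz
      simp only [List.mem_append, List.mem_singleton] at hz
      rcases hz with hz | rfl
      · exact ht _ _ _ (ih.2 z hz) hp.1.1
      · exact hr _

theorem path_len {k : ℕ} (hT : T.IsRT k) (y : T.carrier) (l : List T.carrier)
    (hl : PathTo T y l) : l.length ≤ k := by
  classical
  obtain ⟨h1, h2⟩ := path_props hT.1 y l hl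
  rw [← List.toFinset_card_of_nodup h1]
  apply hT.2.2
  have hF := hT.1
  obtain ⟨hr, ha, ht, hfin, hch⟩ := hF
  intro a haa b hb hab
  simp only [List.coe_toFinset, Set.mem_setOf_eq] at haa hb
  by_cases e1 : a = y
  · subst e1; exact Or.inr (h2 _ hb)
  · by_cases e2 : b = y
    · subst e2; exact Or.inl (h2 _ haa)
    · exact hch y ⟨h2 _ haa, e1⟩ ⟨h2 _ hb, e2⟩ hab

theorem path_prefix (h : T.IsForestOrder) (g : T.carrier → List T.carrier)
    (hg : ∀ x, PathTo T x (g x)) (x y : T.carrier) (hxy : T.le x y) : g x <+: g y := by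
  induction y using (f_wf h).induction with
  | _ y ih =>
    by_cases e : x = y
    · subst e; exact List.prefix_rfl
    · obtain ⟨p, hp, hxp⟩ := exists_cov h x y ⟨hxy, e⟩
      rw [path_unique h y _ _ (hg y) (.step _ _ _ hp (hg p))]
      exact (ih p hp.1 hxp).trans (List.prefix_append _ _)

theorem path_last (y : T.carrier) (l : List T.carrier)
    (hl : PathTo T y l) : ∃ m, l = m ++ [y] := by
  cases hl with
  | root => exact ⟨[], rfl⟩
  | step p _ l => exact ⟨l, rfl⟩

end helpers

/-- Couniversal property of `G_k A`: every σ-homomorphism from the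
underlying σ-structure of a forest-ordered σ-structure `T` of height ≤ `k` to `A`
factors uniquely through the counit `ε_A` via a morphism `T → G_k A` of
forest-ordered σ-structures. -/
theorem stmt6 {σ : Type} {ar : σ → ℕ} (har : ∀ r, 0 < ar r)
    {A : Type} (SA : Interp σ ar A) (k : ℕ) (hk : 0 < k)
    (T : OStruct σ ar) (hT : T.IsRT k)
    (f : T.carrier → A) (hf : IsHom T.interp SA f) :
    ∃! fhat : T.carrier → EkCarrier k A,
      IsFMor T (GkO k SA) fhat ∧ ∀ x, εE (fhat x) = f x := by
  have hF := hT.1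
  choose g hg using path_exists hF
  have hlast : ∀ x, ∃ m, g x = m ++ [x] := fun x => path_last x _ (hg x)
  let fh : T.carrier → EkCarrier k A := fun x =>
    ⟨(g x).map f, by obtain ⟨m, hm⟩ := hlast x; simp [hm],
      by rw [List.length_map]; exact path_len hT x _ (hg x)⟩
  have hε : ∀ x, εE (fh x) = f x := by
    intro x
    obtain ⟨m, hm⟩ := hlast x
    simp [εE, fh, hm]
  refine ⟨fh, ⟨⟨?_, ?_, ?_⟩, hε⟩, ?_⟩
  · intro r t ht
    refine ⟨?_, ?_⟩
    · intro i j
      have hmono : ∀ x y, T.le x y → (fh x).1 <+: (fh y).1 := fun x y hxy =>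
        (path_prefix hF g hg x y hxy).map f
      by_cases e : t i = t j
      · left; simp only [e]; exact List.prefix_rfl
      · rcases hT.2.1 (t i) (t j) ⟨e, r, t, ht, ⟨i, rfl⟩, ⟨j, rfl⟩⟩ with h | h
        · exact Or.inl (hmono _ _ h)
        · exact Or.inr (hmono _ _ h)
    · simp only [hε]
      exact hf r t ht
  · intro x hx
    apply gk_root' SA _ (f x)
    simp only [fh]
    rw [path_unique hF x _ _ (hg x) (.root _ hx)]
    rfl
  · intro x y hxy
    apply gk_cov' SA _ _ (f y)
    simp only [fh]
    rw [path_unique hF y _ _ (hg y) (.step _ _ _ hxy (hg x))]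
    simp
  · rintro h ⟨⟨-, h2, h3⟩, h4⟩
    funext y
    induction y using (f_wf hF).induction with
    | _ y ih =>
      apply Subtype.ext
      rcases root_or_cov hF y with hy | ⟨p, hp⟩
      · rw [gk_root SA hk _ (h2 y hy), h4]
        simp only [fh]
        rw [path_unique hF y _ _ (hg y) (.root _ hy)]
        rfl
      · rw [gk_cov SA _ _ (h3 p y hp), h4, ih p hp.1]
        simp only [fh]
        rw [path_unique hF y _ _ (hg y) (.step _ _ _ hp (hg p))]
        simp

end SP
end

section
/- Let σ be a relational vocabulary all of whose relation symbols have arity at most 2, and let k ≥ 0. The modal comonad M_k on pointed Kripke structures is idempotent: for every pointed Kripke structure (A, a), the comultiplication δ_{(A,a)} : M_k(A, a) → M_k M_k(A, a), which sends a sequence to the sequence of its prefixes (with the same relation labels), is an isomorphism of pointed σ-structures; in particular M_k M_k(A, a) ≅ M_k(A, a). -/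
namespace SP


variable {σ : Type} {ar : σ → ℕ}

variable {σ : Type} {ar : σ → ℕ}

/-- The last element of a run, defaulting to the starting point `b`. -/
def lastOf {β : Type} (b : β) (s : List (σ × β)) : β :=
  s.getLast?.elim b Prod.snd

/-- The pair `(x, y)` as an `ar r`-tuple (used when `ar r = 2`). -/
def stepTuple (r : σ) {A : Type} (x y : A) : Fin (ar r) → A :=
  fun i => if (i : ℕ) = 0 then x else y

/-- Validity of a run: the sequence `[a, R_1, a_1, …, R_j, a_j]`, encoded as the list
`[(R_1, a_1), …, (R_j, a_j)]` starting from `a`, is a run iff each `R_i` is binary and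
`(a_{i-1}, a_i) ∈ R_i^A`. -/
def MValid {A : Type} (SA : Interp σ ar A) (a : A) (s : List (σ × A)) : Prop :=
  ∀ (i : ℕ) (h : i < s.length),
    ar (s.get ⟨i, h⟩).1 = 2 ∧
    stepTuple (s.get ⟨i, h⟩).1 (lastOf a (s.take i)) (s.get ⟨i, h⟩).2
      ∈ SA (s.get ⟨i, h⟩).1

/-- The universe of `M_k (A, a)`: runs from `a` of length at most `k` (the depth-`k`
unravelling of `A` from `a`). -/
def MCarrier (k : ℕ) {A : Type} (SA : Interp σ ar A) (a : A) : Type :=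
  { s : List (σ × A) // s.length ≤ k ∧ MValid SA a s }

/-- The distinguished point of `M_k (A, a)`: the one-element run `[a]`. -/
def MPt (k : ℕ) {A : Type} (SA : Interp σ ar A) (a : A) : MCarrier k SA a :=
  ⟨[], by simp, by intro i h; simp at h⟩

/-- The interpretation of the relation symbols on `M_k (A, a)`: a unary `P` holds of a
run iff it holds of its last element; a binary `R` relates `s` and `t` iff
`t = s ++ [(R, b)]` for some `b`. -/
def MInterp (k : ℕ) {A : Type} (SA : Interp σ ar A) (a : A) :
    Interp σ ar (MCarrier k SA a) :=
  fun r =>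
    { t | (∃ _h : ar r = 1, (fun _ => lastOf a (t ⟨0, by omega⟩).1) ∈ SA r) ∨
          (∃ _h : ar r = 2, ∃ b : A,
              (t ⟨1, by omega⟩).1 = (t ⟨0, by omega⟩).1 ++ [(r, b)]) }

theorem MValid.take {A : Type} {SA : Interp σ ar A} {a : A} {s : List (σ × A)}
    (hv : MValid SA a s) (n : ℕ) : MValid SA a (s.take n) := by
  intro i h
  have h2 : i < n ∧ i < s.length := by
    simpa [List.length_take, Nat.lt_min] using h
  have hget : ((s.take n).get ⟨i, h⟩) = s.get ⟨i, h2.2⟩ := by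
    simp
  have htk : (s.take n).take i = s.take i := by
    rw [List.take_take, Nat.min_eq_left (Nat.le_of_lt h2.1)]
  rw [hget, htk]
  exact hv i h2.2

theorem lastOf_take_ofFn {β : Type} {n : ℕ} (F : Fin n → σ × β) (b : β) (i : ℕ)
    (hi : i ≤ n) :
    lastOf b ((List.ofFn F).take i) =
      if h : 0 < i then (F ⟨i - 1, by omega⟩).2 else b := by
  unfold lastOf
  rcases Nat.eq_zero_or_pos i with h0 | h0
  · subst h0; simp
  · rw [dif_pos h0, List.getLast?_eq_getElem?]
    have hlen : ((List.ofFn F).take i).length = i := by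
      simp [List.length_take]; omega
    rw [hlen, List.getElem?_take_of_lt (by omega), List.getElem?_ofFn]
    have hi1 : i - 1 < n := by omega
    simp [List.ofFnNthVal, hi1]


/-- The prefix of length `i + 1` of a run, as an element of `M_k (A, a)`. -/
def takePre {k : ℕ} {A : Type} {SA : Interp σ ar A} {a : A} (s : MCarrier k SA a)
    (i : Fin s.1.length) : MCarrier k SA a :=
  ⟨s.1.take ((i : ℕ) + 1),
    by have := s.2.1; simp only [List.length_take]; omega,
    s.2.2.take _⟩

/-- The underlying list of `δ_{(A,a)} s`: the sequence of prefixes of `s`, with the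
same relation labels. -/
def δMList {k : ℕ} {A : Type} {SA : Interp σ ar A} {a : A} (s : MCarrier k SA a) :
    List (σ × MCarrier k SA a) :=
  List.ofFn (fun i : Fin s.1.length => ((s.1.get i).1, takePre s i))

theorem length_δMList {k : ℕ} {A : Type} {SA : Interp σ ar A} {a : A}
    (s : MCarrier k SA a) : (δMList s).length = s.1.length := by
  simp [δMList]

theorem get_δMList {k : ℕ} {A : Type} {SA : Interp σ ar A} {a : A}
    (s : MCarrier k SA a) (i : ℕ) (h : i < (δMList s).length) (hi : i < s.1.length) :
    (δMList s).get ⟨i, h⟩ = ((s.1.get ⟨i, hi⟩).1, takePre s ⟨i, hi⟩) := by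
  simp [δMList]

theorem lastOf_take_δMList {k : ℕ} {A : Type} {SA : Interp σ ar A} {a : A}
    (s : MCarrier k SA a) (i : ℕ) (hi : i ≤ s.1.length) :
    lastOf (MPt k SA a) ((δMList s).take i) =
      if _h : 0 < i then takePre s ⟨i - 1, by omega⟩ else MPt k SA a := by
  unfold δMList
  rw [lastOf_take_ofFn _ _ _ hi]

theorem δM_valid {k : ℕ} {A : Type} {SA : Interp σ ar A} {a : A}
    (s : MCarrier k SA a) :
    MValid (MInterp k SA a) (MPt k SA a) (δMList s) := by
  intro i h
  have hi : i < s.1.length := by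
    have := length_δMList s; omega
  rw [get_δMList s i h hi]
  refine ⟨(s.2.2 i hi).1, ?_⟩
  rw [lastOf_take_δMList s i (le_of_lt hi)]
  simp only [MInterp, Set.mem_setOf_eq]
  refine Or.inr ⟨(s.2.2 i hi).1, (s.1.get ⟨i, hi⟩).2, ?_⟩
  have hts : s.1.take (i + 1) = s.1.take i ++ [s.1.get ⟨i, hi⟩] := by
    rw [← List.take_concat_get' s.1 i hi]
    simp
  rcases Nat.eq_zero_or_pos i with h0 | h0
  · subst h0
    rw [dif_neg (by omega)]
    show (takePre s ⟨0, hi⟩).1 = (MPt k SA a).1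
        ++ [((s.1.get ⟨0, hi⟩).1, (s.1.get ⟨0, hi⟩).2)]
    simp only [takePre, MPt]
    rw [hts]
    simp
  · rw [dif_pos h0]
    show (takePre s ⟨i, hi⟩).1 = (takePre s ⟨i - 1, by omega⟩).1
        ++ [((s.1.get ⟨i, hi⟩).1, (s.1.get ⟨i, hi⟩).2)]
    simp only [takePre]
    have h1 : i - 1 + 1 = i := by omega
    rw [h1, hts]

/-- The comultiplication `δ_{(A,a)} : M_k (A, a) → M_k M_k (A, a)`, sending a run to
the run of its prefixes (with the same relation labels). -/
def δM (k : ℕ) {A : Type} (SA : Interp σ ar A) (a : A) (s : MCarrier k SA a) :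
    MCarrier k (MInterp k SA a) (MPt k SA a) :=
  ⟨δMList s, by rw [length_δMList]; exact le_trans (le_of_eq rfl) (s.2.1), δM_valid s⟩

theorem aux_lastOf_append {β : Type} (b : β) (s : List (σ × β)) (x : σ × β) :
    lastOf b (s ++ [x]) = x.2 := by
  simp [lastOf]

theorem aux_lastOf_take {β : Type} (b : β) (s : List (σ × β)) (i : ℕ) (h : i < s.length) :
    lastOf b (s.take (i + 1)) = (s.get ⟨i, h⟩).2 := by
  rw [← List.take_concat_get' s i h, aux_lastOf_append]
  rfl

theorem aux_step {k : ℕ} {A : Type} {SA : Interp σ ar A} {a : A}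
    {t : List (σ × MCarrier k SA a)} (hv : MValid (MInterp k SA a) (MPt k SA a) t)
    (i : ℕ) (h : i < t.length) :
    ∃ b : A, (lastOf (MPt k SA a) (t.take (i + 1))).1 =
      (lastOf (MPt k SA a) (t.take i)).1 ++ [((t.get ⟨i, h⟩).1, b)] := by
  obtain ⟨h2, hm⟩ := hv i h
  rw [aux_lastOf_take _ _ _ h]
  rcases hm with ⟨h1, _⟩ | ⟨_, b, hb⟩
  · omega
  · exact ⟨b, hb⟩

theorem aux_len {k : ℕ} {A : Type} {SA : Interp σ ar A} {a : A}
    {t : List (σ × MCarrier k SA a)} (hv : MValid (MInterp k SA a) (MPt k SA a) t)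
    (i : ℕ) (h : i ≤ t.length) :
    (lastOf (MPt k SA a) (t.take i)).1.length = i := by
  induction i with
  | zero => rfl
  | succ n ih =>
    obtain ⟨b, hb⟩ := aux_step hv n h
    rw [hb, List.length_append, ih (by omega)]
    rfl

theorem aux_pre {k : ℕ} {A : Type} {SA : Interp σ ar A} {a : A}
    {t : List (σ × MCarrier k SA a)} (hv : MValid (MInterp k SA a) (MPt k SA a) t)
    (i j : ℕ) (hij : i ≤ j) (h : j ≤ t.length) :
    (lastOf (MPt k SA a) (t.take i)).1 <+: (lastOf (MPt k SA a) (t.take j)).1 := by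
  induction j, hij using Nat.le_induction with
  | base => exact List.prefix_rfl
  | succ n hn ih =>
    obtain ⟨b, hb⟩ := aux_step hv n h
    rw [hb]
    exact (ih (by omega)).trans (List.prefix_append _ _)

theorem aux_g_δ {k : ℕ} {A : Type} {SA : Interp σ ar A} {a : A} (s : MCarrier k SA a) :
    lastOf (MPt k SA a) (δM k SA a s).1 = s := by
  have h := lastOf_take_δMList s s.1.length le_rfl
  rw [List.take_of_length_le (by rw [length_δMList])] at h
  refine Eq.trans h ?_
  apply Subtype.ext
  split_ifs with h0
  · simp only [takePre]
    rw [List.take_of_length_le (by omega)]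
  · have : s.1 = [] := List.length_eq_zero_iff.mp (by omega)
    rw [this]; rfl

theorem aux_δ_g {k : ℕ} {A : Type} {SA : Interp σ ar A} {a : A}
    (t : MCarrier k (MInterp k SA a) (MPt k SA a)) :
    δM k SA a (lastOf (MPt k SA a) t.1) = t := by
  obtain ⟨t, hk, hv⟩ := t
  apply Subtype.ext
  have hl := aux_len hv t.length le_rfl
  have hp := fun i hi => aux_pre hv i t.length hi le_rfl
  rw [List.take_length] at hl hp
  show δMList (lastOf (MPt k SA a) t) = t
  apply List.ext_get
  · rw [length_δMList, hl]
  · intro i h1 h2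
    rw [get_δMList _ i h1 (by omega)]
    have hq := hp (i + 1) h2
    have hli := aux_len hv (i + 1) h2
    have hli0 := aux_len hv i (by omega)
    obtain ⟨b, hb⟩ := aux_step hv i h2
    apply Prod.ext
    · obtain ⟨w, hw⟩ := hq
      have : (lastOf (MPt k SA a) t).1[i]? = some ((t.get ⟨i, h2⟩).1, b) := by
        rw [← hw, hb]
        simp [List.getElem?_append, hli0]
      obtain ⟨_, h3⟩ := List.getElem?_eq_some_iff.mp this
      simp only [List.get_eq_getElem] at h3 ⊢
      rw [h3]
    · apply Subtype.ext
      have := List.prefix_iff_eq_take.mp hq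
      rw [hli, aux_lastOf_take _ _ _ h2] at this
      exact this.symm

theorem aux_hom_δ {A : Type} (SA : Interp σ ar A) (a : A) (k : ℕ) :
    IsHom (MInterp k SA a) (MInterp k (MInterp k SA a) (MPt k SA a)) (δM k SA a) := by
  intro r t ht
  rcases ht with ⟨h, hm⟩ | ⟨h, b, hb⟩
  · refine Or.inl ⟨h, Or.inl ⟨h, ?_⟩⟩
    simp only [aux_g_δ]
    exact hm
  · refine Or.inr ⟨h, t ⟨1, by omega⟩, ?_⟩
    simp only
    generalize t ⟨1, by omega⟩ = y at *
    generalize t ⟨0, by omega⟩ = x at *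
    show δMList y = δMList x ++ [(r, y)]
    have hl : y.1.length = x.1.length + 1 := by rw [hb]; simp
    apply List.ext_get
    · simp [length_δMList, hl]
    · intro i h1 h2
      have h1' := h1
      rw [length_δMList] at h1'
      rw [get_δMList y i h1 h1']
      rcases Nat.lt_or_ge i x.1.length with hi | hi
      · have e : (δMList x ++ [(r, y)]).get ⟨i, h2⟩ =
            (δMList x).get ⟨i, by rw [length_δMList]; exact hi⟩ := by
          simp only [List.get_eq_getElem]
          rw [List.getElem_append_left]
        rw [e, get_δMList x i _ hi]
        apply Prod.ext
        · simp [hb, List.getElem_append_left, hi]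
        · apply Subtype.ext
          simp only [takePre]
          rw [hb, List.take_append_of_le_length (by omega)]
      · have hi' : i = x.1.length := by omega
        subst hi'
        have e : (δMList x ++ [(r, y)]).get ⟨_, h2⟩ = (r, y) := by
          simp only [List.get_eq_getElem]
          rw [List.getElem_append_right (by rw [length_δMList])]
          simp
        rw [e]
        apply Prod.ext
        · simp [hb]
        · apply Subtype.ext
          simp only [takePre]
          rw [List.take_of_length_le (by omega)]

theorem aux_hom_g {A : Type} (SA : Interp σ ar A) (a : A) (k : ℕ) :
    IsHom (MInterp k (MInterp k SA a) (MPt k SA a)) (MInterp k SA a)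
      (fun t => lastOf (MPt k SA a) t.1) := by
  intro r t ht
  rcases ht with ⟨h, hm⟩ | ⟨h, b, hb⟩
  · rcases hm with ⟨_, hm⟩ | ⟨h', _⟩
    · exact Or.inl ⟨h, hm⟩
    · omega
  · refine Or.inr ⟨h, ?_⟩
    simp only
    generalize t ⟨1, by omega⟩ = y at *
    generalize t ⟨0, by omega⟩ = x at *
    obtain ⟨y, hk, hv⟩ := y
    simp only at hb
    subst hb
    obtain ⟨c, hc⟩ := aux_step hv x.1.length (by simp)
    refine ⟨c, ?_⟩
    rw [List.take_of_length_le (by simp)] at hc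
    simpa using hc

/-- For a vocabulary all of whose relation symbols have arity at
most 2 and `k ≥ 0`, the modal comonad `M_k` is idempotent: the comultiplication
`δ_{(A,a)} : M_k (A,a) → M_k M_k (A,a)`, sending a run to the run of its prefixes
(with the same relation labels), is an isomorphism of pointed σ-structures; in
particular `M_k M_k (A,a) ≅ M_k (A,a)`. -/
theorem stmt12 {σ : Type} {ar : σ → ℕ} (har : ∀ r, ar r = 1 ∨ ar r = 2)
    {A : Type} (SA : Interp σ ar A) (a : A) (k : ℕ) :
    Function.Bijective (δM k SA a) ∧
    IsHom (MInterp k SA a) (MInterp k (MInterp k SA a) (MPt k SA a)) (δM k SA a) ∧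
    δM k SA a (MPt k SA a) = MPt k (MInterp k SA a) (MPt k SA a) ∧
    ∃ g : MCarrier k (MInterp k SA a) (MPt k SA a) → MCarrier k SA a,
      (∀ s, g (δM k SA a s) = s) ∧ (∀ t, δM k SA a (g t) = t) ∧
      IsHom (MInterp k (MInterp k SA a) (MPt k SA a)) (MInterp k SA a) g ∧
      g (MPt k (MInterp k SA a) (MPt k SA a)) = MPt k SA a := by
  have hpt : δM k SA a (MPt k SA a) = MPt k (MInterp k SA a) (MPt k SA a) := rfl
  refine ⟨Function.bijective_iff_has_inverse.mpr
    ⟨fun t => lastOf (MPt k SA a) t.1, aux_g_δ, aux_δ_g⟩, aux_hom_δ SA a k, hpt,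
    fun t => lastOf (MPt k SA a) t.1, aux_g_δ, aux_δ_g, aux_hom_g SA a k, rfl⟩

end SP
end
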